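/- The proportion of numerical semigroups of genus g whose nonzero left elements are coprime, among all numerical semigroups of genus g, tends to 1 as g → ∞. That is, with S_g^{∞̄} = {S of genus g : gcd(L(S) \ {0}) = 1}, one has lim_{g→∞} #S_g^{∞̄}/n_g = 1. -/

import Mathlib

/-- A numerical semigroup: an additive submonoid of ℕ with finite complement. -/
structure NumericalSemigroup where
  carrier : Set ℕ
  zero_mem : 0 ∈ carrier
  add_mem : ∀ ⦃a b : ℕ⦄, a ∈ carrier → b ∈ carrier → a + b ∈ carrier
  cofinite : (carrierᶜ : Set ℕ).Finite

namespace NumericalSemigroup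

/-- The genus: the number of gaps. -/
noncomputable def genus (S : NumericalSemigroup) : ℕ := S.carrierᶜ.ncard

/-- The multiplicity: the smallest nonzero element. -/
noncomputable def multiplicity (S : NumericalSemigroup) : ℕ :=
  sInf {n : ℕ | n ∈ S.carrier ∧ n ≠ 0}

/-- The Frobenius number: the largest gap. -/
noncomputable def frobenius (S : NumericalSemigroup) : ℕ := sSup S.carrierᶜ

/-- The left elements: the elements of `S` smaller than the Frobenius number. -/
def leftElements (S : NumericalSemigroup) : Set ℕ :=
  {s : ℕ | s ∈ S.carrier ∧ s < S.frobenius}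

end NumericalSemigroup

/-- The gcd of a set of natural numbers: the common divisor that is divisible by
every common divisor (so `setGcd ∅ = 0`). -/
noncomputable def setGcd (A : Set ℕ) : ℕ :=
  sInf {d : ℕ | (∀ a ∈ A, d ∣ a) ∧ ∀ e : ℕ, (∀ a ∈ A, e ∣ a) → e ∣ d}

/-- The constant γ = (5 + √5)/10. -/
noncomputable def gamma : ℝ := (5 + Real.sqrt 5) / 10

/-- `S` belongs to an infinite chain in the semigroup tree. -/
def InInfiniteChain (S : NumericalSemigroup) : Prop :=
  ∃ f : ℕ → NumericalSemigroup, f 0 = S ∧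
    ∀ i : ℕ, (f (i + 1)).carrier ≠ Set.univ ∧
      (f i).carrier = (f (i + 1)).carrier ∪ {(f (i + 1)).frobenius}

namespace NumericalSemigroup

theorem carrier_injective : Function.Injective carrier := by
  rintro ⟨A, _, _, _⟩ ⟨B, _, _, _⟩ h
  cases h
  rfl

/-- The gaps of a numerical semigroup, as a finset. -/
noncomputable def gaps (S : NumericalSemigroup) : Finset ℕ := S.cofinite.toFinset

theorem mem_gaps {S : NumericalSemigroup} {n : ℕ} : n ∈ S.gaps ↔ n ∉ S.carrier := by
  simp [gaps]

theorem card_gaps (S : NumericalSemigroup) : S.gaps.card = S.genus :=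
  (Set.ncard_eq_toFinset_card _ S.cofinite).symm

theorem gaps_injective : Function.Injective gaps := by
  intro S T h
  apply carrier_injective
  ext n
  have := Finset.ext_iff.1 h n
  rw [mem_gaps, mem_gaps] at this
  exact not_iff_not.1 this

open Classical in
/-- If `d * n` is a gap, then at least half of `0, d, …, d * n` are gaps. -/
theorem succ_le_two_mul_card_filter (S : NumericalSemigroup) {d n : ℕ} (h : d * n ∉ S.carrier) :
    n + 1 ≤ 2 * ((Finset.range (n + 1)).filter fun i => d * i ∉ S.carrier).card := by
  set G := (Finset.range (n + 1)).filter fun i => d * i ∉ S.carrier with hG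
  have hsub : Finset.range (n + 1) ⊆ G ∪ G.image fun i => n - i := by
    intro i hi
    have hin : i ≤ n := Nat.lt_succ_iff.1 (Finset.mem_range.1 hi)
    by_cases hiS : d * i ∈ S.carrier
    · refine Finset.mem_union_right _ (Finset.mem_image.2 ⟨n - i, ?_, by omega⟩)
      refine Finset.mem_filter.2 ⟨Finset.mem_range.2 (by omega), fun hi' => h ?_⟩
      have := S.add_mem hiS hi'
      rwa [← mul_add, Nat.add_sub_cancel' hin] at this
    · exact Finset.mem_union_left _ (Finset.mem_filter.2 ⟨hi, hiS⟩)
  have h₁ := (Finset.card_le_card hsub).trans (Finset.card_union_le _ _)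
  have h₂ : (G.image fun i => n - i).card ≤ G.card := Finset.card_image_le
  rw [Finset.card_range] at h₁
  omega

theorem lt_two_mul_genus (S : NumericalSemigroup) {n : ℕ} (h : n ∉ S.carrier) :
    n < 2 * S.genus := by
  classical
  have h₁ := S.succ_le_two_mul_card_filter (d := 1) (n := n) (by simpa using h)
  have h₂ : ((Finset.range (n + 1)).filter fun i => 1 * i ∉ S.carrier).card ≤ S.gaps.card := by
    refine Finset.card_le_card fun i hi => ?_
    simpa [mem_gaps] using (Finset.mem_filter.1 hi).2
  rw [card_gaps] at h₂
  omega

theorem finite_genus_eq (g : ℕ) : {S : NumericalSemigroup | S.genus = g}.Finite := by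
  refine Set.Finite.of_finite_image (f := gaps) ?_ gaps_injective.injOn
  refine (Finset.range (2 * g)).powerset.finite_toSet.subset ?_
  rintro _ ⟨S, rfl, rfl⟩
  exact Finset.mem_coe.2 (Finset.mem_powerset.2 fun n hn =>
    Finset.mem_range.2 (S.lt_two_mul_genus (mem_gaps.1 hn)))

theorem mem_of_frobenius_lt (S : NumericalSemigroup) {n : ℕ} (h : S.frobenius < n) :
    n ∈ S.carrier := by
  by_contra hn
  exact h.not_ge (le_csSup S.cofinite.bddAbove hn)

theorem frobenius_notMem (S : NumericalSemigroup) (h : 0 < S.genus) :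
    S.frobenius ∉ S.carrier := by
  have hne : (S.carrierᶜ).Nonempty := by
    rw [Set.nonempty_iff_ne_empty]
    intro h0
    simp [genus, h0] at h
  exact Nat.sSup_mem hne S.cofinite.bddAbove

/-- If `d ≥ 2` divides all left elements, then the gaps below the Frobenius number that are
multiples of `d` are small. -/
theorem three_mul_lt_two_mul_genus (S : NumericalSemigroup) {d n : ℕ} (hd : 2 ≤ d)
    (hL : ∀ a ∈ S.leftElements, d ∣ a) (hn : d * n < S.frobenius) (h : d * n ∉ S.carrier) :
    3 * n < 2 * S.genus := by
  classical
  have h₁ := S.succ_le_two_mul_card_filter h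
  set G := (Finset.range (n + 1)).filter fun i => d * i ∉ S.carrier with hG
  have hdisj : Disjoint (G.image fun i => d * i) ((Finset.range n).image fun i => d * i + 1) := by
    rw [Finset.disjoint_left]
    intro x hx hy
    obtain ⟨i, -, rfl⟩ := Finset.mem_image.1 hx
    obtain ⟨j, -, hj⟩ := Finset.mem_image.1 hy
    have : d ∣ 1 := (Nat.dvd_add_right (dvd_mul_right d j)).1 (hj ▸ dvd_mul_right d i)
    have := Nat.le_of_dvd one_pos this
    omega
  have hsub : (G.image fun i => d * i) ∪ ((Finset.range n).image fun i => d * i + 1) ⊆ S.gaps := by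
    intro x hx
    rw [mem_gaps]
    rcases Finset.mem_union.1 hx with hx | hx
    · obtain ⟨i, hi, rfl⟩ := Finset.mem_image.1 hx
      exact (Finset.mem_filter.1 hi).2
    · obtain ⟨j, hj, rfl⟩ := Finset.mem_image.1 hx
      intro hmem
      have hjn : d * (j + 1) ≤ d * n := Nat.mul_le_mul_left d (Finset.mem_range.1 hj)
      rw [mul_add, mul_one] at hjn
      have := (Nat.dvd_add_right (dvd_mul_right d j)).1 (hL _ ⟨hmem, by omega⟩)
      have := Nat.le_of_dvd one_pos this
      omega
  have h₂ := Finset.card_le_card hsub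
  rw [Finset.card_union_of_disjoint hdisj, card_gaps,
    Finset.card_image_of_injective _ fun i j hij => Nat.eq_of_mul_eq_mul_left (by omega) hij,
    Finset.card_image_of_injective _ fun i j hij =>
      Nat.eq_of_mul_eq_mul_left (by omega : 0 < d) (Nat.succ_injective hij),
    Finset.card_range] at h₂
  omega

theorem exists_dvd_of_setGcd_ne_one {A : Set ℕ} (h : setGcd A ≠ 1) :
    ∃ d, 2 ≤ d ∧ ∀ a ∈ A, d ∣ a := by
  by_contra! hd
  have h0 : ¬ ∀ a ∈ A, 0 ∣ a := by
    intro h0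
    obtain ⟨a, ha, ha'⟩ := hd 2 le_rfl
    exact ha' (zero_dvd_iff.1 (h0 a ha) ▸ dvd_zero 2)
  have hone : ∀ e, (∀ a ∈ A, e ∣ a) → e = 1 := by
    intro e he
    have : e < 2 := by
      by_contra! h2
      obtain ⟨a, ha, ha'⟩ := hd e h2
      exact ha' (he a ha)
    interval_cases e
    · exact absurd he h0
    · rfl
  apply h
  have : {d : ℕ | (∀ a ∈ A, d ∣ a) ∧ ∀ e : ℕ, (∀ a ∈ A, e ∣ a) → e ∣ d} = {1} := by
    ext d
    constructor
    · exact fun hd => hone d hd.1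
    · rintro rfl
      exact ⟨fun a _ => one_dvd a, fun e he => (hone e he).dvd⟩
  rw [setGcd, this, csInf_singleton]

theorem exists_le_dvd_leftElements (S : NumericalSemigroup)
    (h : setGcd (S.leftElements \ {0}) ≠ 1) :
    ∃ d, 2 ≤ d ∧ d ≤ S.frobenius + 2 ∧ ∀ a ∈ S.leftElements, d ∣ a := by
  obtain ⟨d, hd, hdvd⟩ := exists_dvd_of_setGcd_ne_one h
  by_cases hne : ∃ a ∈ S.leftElements, a ≠ 0
  · obtain ⟨a, ha, ha0⟩ := hne
    refine ⟨d, hd, ?_, fun b hb => ?_⟩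
    · have := Nat.le_of_dvd (Nat.pos_of_ne_zero ha0) (hdvd a ⟨ha, ha0⟩)
      have := ha.2
      omega
    · by_cases hb0 : b = 0
      · exact hb0 ▸ dvd_zero d
      · exact hdvd b ⟨hb, hb0⟩
  · push Not at hne
    exact ⟨2, le_rfl, by omega, fun b hb => hne b hb ▸ dvd_zero 2⟩

open Classical in
/-- A semigroup whose left elements are all divisible by `d ≥ 2` is determined by `d`, its
Frobenius number, and its small multiples of `d`. -/
theorem carrier_subset_of_dvd_leftElements {S T : NumericalSemigroup} {g d : ℕ} (hg : 0 < g)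
    (hS : S.genus = g) (hT : T.genus = g) (hd : 2 ≤ d)
    (hSd : ∀ a ∈ S.leftElements, d ∣ a) (hTd : ∀ a ∈ T.leftElements, d ∣ a)
    (hF : S.frobenius = T.frobenius)
    (h : ((Finset.range (2 * g / 3 + 1)).filter fun i => d * i ∈ S.carrier) =
      (Finset.range (2 * g / 3 + 1)).filter fun i => d * i ∈ T.carrier) :
    S.carrier ⊆ T.carrier := by
  intro x hx
  rcases lt_trichotomy x S.frobenius with hlt | rfl | hgt
  · obtain ⟨n, rfl⟩ := hSd x ⟨hx, hlt⟩
    by_contra hxT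
    have hn := T.three_mul_lt_two_mul_genus hd hTd (hF ▸ hlt) hxT
    have : n ∈ (Finset.range (2 * g / 3 + 1)).filter fun i => d * i ∈ S.carrier :=
      Finset.mem_filter.2 ⟨Finset.mem_range.2 (by omega), hx⟩
    rw [h] at this
    exact hxT (Finset.mem_filter.1 this).2
  · exact absurd hx (S.frobenius_notMem (hS ▸ hg))
  · exact T.mem_of_frobenius_lt (hF ▸ hgt)

theorem ncard_setGcd_ne_one_le {g : ℕ} (hg : 0 < g) :
    {S : NumericalSemigroup | S.genus = g ∧ setGcd (S.leftElements \ {0}) ≠ 1}.ncard ≤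
      (2 * g + 2) ^ 2 * 2 ^ (2 * g / 3 + 1) := by
  classical
  choose! d hd hdF hdvd using exists_le_dvd_leftElements
  let code : NumericalSemigroup → ℕ × ℕ × Finset ℕ := fun S =>
    (S.frobenius, d S, (Finset.range (2 * g / 3 + 1)).filter fun i => d S * i ∈ S.carrier)
  let target : Finset (ℕ × ℕ × Finset ℕ) :=
    Finset.range (2 * g + 2) ×ˢ Finset.range (2 * g + 2) ×ˢ
      (Finset.range (2 * g / 3 + 1)).powerset
  have hcard : target.card = (2 * g + 2) ^ 2 * 2 ^ (2 * g / 3 + 1) := by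
    simp only [target, Finset.card_product, Finset.card_range, Finset.card_powerset]
    ring
  rw [← hcard, ← Set.ncard_coe_finset]
  refine Set.ncard_le_ncard_of_injOn code ?_ ?_ target.finite_toSet
  · rintro S ⟨hS, hgcd⟩
    have hF := S.lt_two_mul_genus (S.frobenius_notMem (hS ▸ hg))
    have := hdF S hgcd
    simp only [target, code, Finset.coe_product, Set.mem_prod, Finset.mem_coe, Finset.mem_range,
      Finset.mem_powerset]
    exact ⟨by omega, by omega, Finset.filter_subset _ _⟩
  · rintro S ⟨hS, hSgcd⟩ T ⟨hT, hTgcd⟩ hST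
    obtain ⟨hF, hdd, hA⟩ : S.frobenius = T.frobenius ∧ d S = d T ∧ _ := by
      simpa only [code, Prod.mk.injEq] using hST
    have hSd := hdvd S hSgcd
    rw [hdd] at hA hSd
    exact carrier_injective <| Set.Subset.antisymm
      (carrier_subset_of_dvd_leftElements hg hS hT (hd T hTgcd) hSd (hdvd T hTgcd) hF hA)
      (carrier_subset_of_dvd_leftElements hg hT hS (hd T hTgcd) (hdvd T hTgcd) hSd hF.symm hA.symm)

/-- The semigroup of multiplicity `a + 1` whose gaps are `1, …, a` and `a + 2 + i` for `i ∈ B`. -/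
def ofSubset (a : ℕ) (B : Finset ℕ) (hB : B ⊆ Finset.range a) : NumericalSemigroup where
  carrier := {n | n = 0 ∨ (a < n ∧ ∀ i ∈ B, n ≠ a + 2 + i)}
  zero_mem := Or.inl rfl
  add_mem := by
    rintro x y (rfl | ⟨hx, hx'⟩) (rfl | ⟨hy, hy'⟩)
    · exact Or.inl rfl
    · exact Or.inr (by simpa using ⟨hy, hy'⟩)
    · exact Or.inr ⟨hx, hx'⟩
    · refine Or.inr ⟨by omega, fun i hi => ?_⟩
      have := Finset.mem_range.1 (hB hi)
      omega
  cofinite := by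
    refine (Finset.range (2 * a + 2)).finite_toSet.subset fun n hn => ?_
    by_contra hlt
    simp only [Finset.mem_coe, Finset.mem_range] at hlt
    refine hn (Or.inr ⟨by omega, fun i hi => ?_⟩)
    have := Finset.mem_range.1 (hB hi)
    omega

theorem mem_ofSubset {a n : ℕ} {B : Finset ℕ} {hB : B ⊆ Finset.range a} :
    n ∈ (ofSubset a B hB).carrier ↔ n = 0 ∨ (a < n ∧ ∀ i ∈ B, n ≠ a + 2 + i) :=
  Iff.rfl

theorem genus_ofSubset {a : ℕ} {B : Finset ℕ} (hB : B ⊆ Finset.range a) :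
    (ofSubset a B hB).genus = a + B.card := by
  have hgaps : (ofSubset a B hB).gaps =
      (Finset.range a).image (fun i => i + 1) ∪ B.image fun i => a + 2 + i := by
    ext n
    simp only [mem_gaps, mem_ofSubset, Finset.mem_union, Finset.mem_image, Finset.mem_range]
    constructor
    · intro h
      push Not at h
      by_cases han : a < n
      · obtain ⟨i, hi, rfl⟩ := h.2 han
        exact Or.inr ⟨i, hi, rfl⟩
      · exact Or.inl ⟨n - 1, by omega, by omega⟩
    · rintro (⟨i, hi, rfl⟩ | ⟨i, hi, rfl⟩) (h | ⟨h, h'⟩)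
      · omega
      · omega
      · omega
      · exact h' i hi rfl
  rw [← card_gaps, hgaps, Finset.card_union_of_disjoint, Finset.card_image_of_injective,
    Finset.card_image_of_injective, Finset.card_range]
  · exact add_right_injective _
  · exact add_left_injective 1
  · rw [Finset.disjoint_left]
    intro x hx hy
    obtain ⟨i, hi, rfl⟩ := Finset.mem_image.1 hx
    obtain ⟨j, -, hj⟩ := Finset.mem_image.1 hy
    have := Finset.mem_range.1 hi
    omega

theorem le_of_ofSubset_eq {a b : ℕ} {A B : Finset ℕ} {hA : A ⊆ Finset.range a}
    {hB : B ⊆ Finset.range b} (h : ofSubset a A hA = ofSubset b B hB) : b ≤ a := by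
  have : a + 1 ∈ (ofSubset a A hA).carrier := Or.inr ⟨by omega, fun i _ => by omega⟩
  rw [h] at this
  rcases this with h | ⟨h, -⟩ <;> omega

theorem subset_of_ofSubset_eq {a : ℕ} {A B : Finset ℕ} {hA : A ⊆ Finset.range a}
    {hB : B ⊆ Finset.range a} (h : ofSubset a A hA = ofSubset a B hB) : A ⊆ B := by
  intro i hi
  have : a + 2 + i ∉ (ofSubset a A hA).carrier := by
    rintro (h0 | ⟨-, h'⟩)
    · omega
    · exact h' i hi rfl
  rw [h, mem_ofSubset] at this
  push Not at this
  obtain ⟨j, hj, hij⟩ := this.2 (by omega)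
  obtain rfl : i = j := by omega
  exact hj

theorem fib_succ_le_ncard_genus_eq (g : ℕ) :
    Nat.fib (g + 1) ≤ {S : NumericalSemigroup | S.genus = g}.ncard := by
  classical
  let source : Finset (Σ _ : ℕ × ℕ, Finset ℕ) :=
    (Finset.HasAntidiagonal.antidiagonal g).sigma fun p => (Finset.range p.1).powersetCard p.2
  have hmem : ∀ x ∈ source, x.1.1 + x.1.2 = g ∧ x.2 ⊆ Finset.range x.1.1 ∧ x.2.card = x.1.2 := by
    intro x hx
    simpa [source, Finset.mem_powersetCard] using hx
  have hcard : source.card = Nat.fib (g + 1) := by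
    simp [source, Finset.card_sigma, Nat.fib_succ_eq_sum_choose]
  rw [← hcard, ← Set.ncard_coe_finset]
  let f : (Σ _ : ℕ × ℕ, Finset ℕ) → NumericalSemigroup := fun x =>
    ofSubset x.1.1 (x.2 ∩ Finset.range x.1.1) Finset.inter_subset_right
  refine Set.ncard_le_ncard_of_injOn f ?_ ?_ (finite_genus_eq g)
  · intro x hx
    obtain ⟨h₁, h₂, h₃⟩ := hmem x hx
    change (ofSubset _ _ _).genus = g
    rw [genus_ofSubset, Finset.inter_eq_left.2 h₂, h₃, h₁]
  · rintro ⟨⟨a, b⟩, A⟩ hx ⟨⟨a', b'⟩, A'⟩ hy hxy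
    obtain ⟨h₁, h₂, -⟩ := hmem _ hx
    obtain ⟨h₁', h₂', -⟩ := hmem _ hy
    dsimp only at h₁ h₂ h₁' h₂'
    obtain rfl : a = a' := le_antisymm (le_of_ofSubset_eq hxy.symm) (le_of_ofSubset_eq hxy)
    obtain rfl : b = b' := by omega
    have hA := (subset_of_ofSubset_eq hxy).antisymm (subset_of_ofSubset_eq hxy.symm)
    dsimp only at hA
    rw [Finset.inter_eq_left.2 h₂, Finset.inter_eq_left.2 h₂'] at hA
    rw [hA]

end NumericalSemigroup

theorem pow_le_two_mul_fib_succ (n : ℕ) : (8 / 5 : ℝ) ^ n ≤ 2 * Nat.fib (n + 1) := by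
  induction n using Nat.twoStepInduction with
  | zero => norm_num
  | one => norm_num
  | more n h₁ h₂ =>
    rw [Nat.fib_add_two, Nat.cast_add]
    have : (0 : ℝ) < (8 / 5) ^ n := by positivity
    rw [pow_succ] at h₂
    rw [pow_add]
    linarith

theorem two_pow_two_mul_div_three_le (g : ℕ) : (2 : ℝ) ^ (2 * g / 3) ≤ (159 / 100) ^ g := by
  refine le_of_pow_le_pow_left₀ three_ne_zero (by positivity) ?_
  calc ((2 : ℝ) ^ (2 * g / 3)) ^ 3 = 2 ^ (2 * g / 3 * 3) := (pow_mul _ _ _).symm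
    _ ≤ 2 ^ (2 * g) := pow_le_pow_right₀ one_le_two (by omega)
    _ = 4 ^ g := by rw [pow_mul]; norm_num
    _ ≤ ((159 / 100) ^ 3) ^ g := by gcongr; norm_num
    _ = ((159 / 100) ^ g) ^ 3 := by rw [← pow_mul, ← pow_mul, mul_comm]

open NumericalSemigroup in
theorem ncard_setGcd_ne_one_div_le {g : ℕ} (hg : 0 < g) :
    ({S : NumericalSemigroup | S.genus = g ∧ setGcd (S.leftElements \ {0}) ≠ 1}.ncard : ℝ) /
      {S : NumericalSemigroup | S.genus = g}.ncard ≤ 64 * ((g : ℝ) ^ 2 * (159 / 160) ^ g) := by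
  have hlow := (pow_le_two_mul_fib_succ g).trans
    (mul_le_mul_of_nonneg_left (Nat.cast_le.2 (fib_succ_le_ncard_genus_eq g)) zero_le_two)
  have hupp : ({S : NumericalSemigroup | S.genus = g ∧
      setGcd (S.leftElements \ {0}) ≠ 1}.ncard : ℝ) ≤ (2 * g + 2) ^ 2 * 2 ^ (2 * g / 3 + 1) :=
    mod_cast ncard_setGcd_ne_one_le hg
  have hpos : (0 : ℝ) < (8 / 5) ^ g := by positivity
  rw [div_le_iff₀ (by linarith)]
  have hg' : (1 : ℝ) ≤ g := mod_cast hg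
  calc _ ≤ ((2 : ℝ) * g + 2) ^ 2 * 2 ^ (2 * g / 3 + 1) := hupp
    _ ≤ (4 * g) ^ 2 * (2 * (159 / 100) ^ g) := by
      rw [pow_succ' 2]
      gcongr
      · linarith
      · exact two_pow_two_mul_div_three_le g
    _ = 32 * ((g : ℝ) ^ 2 * (159 / 160) ^ g) * (8 / 5) ^ g := by
      rw [show (159 / 100 : ℝ) = 159 / 160 * (8 / 5) by norm_num, mul_pow (159 / 160 : ℝ)]
      ring
    _ ≤ 32 * ((g : ℝ) ^ 2 * (159 / 160) ^ g) *
        (2 * {S : NumericalSemigroup | S.genus = g}.ncard) := by gcongr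
    _ = _ := by ring

theorem ncard_genus_eq_pos (g : ℕ) : 0 < {S : NumericalSemigroup | S.genus = g}.ncard :=
  (Nat.fib_pos.2 g.succ_pos).trans_le (NumericalSemigroup.fib_succ_le_ncard_genus_eq g)

theorem ncard_setGcd_eq_one_add (g : ℕ) :
    {S : NumericalSemigroup | S.genus = g ∧ setGcd (S.leftElements \ {0}) = 1}.ncard +
      {S : NumericalSemigroup | S.genus = g ∧ setGcd (S.leftElements \ {0}) ≠ 1}.ncard =
      {S : NumericalSemigroup | S.genus = g}.ncard := by
  have hfin := NumericalSemigroup.finite_genus_eq g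
  rw [← Set.ncard_union_eq (Set.disjoint_left.2 fun S h h' => h'.2 h.2)
    (hfin.subset fun S h => h.1) (hfin.subset fun S h => h.1)]
  congr 1
  ext S
  simp only [Set.mem_union, Set.mem_ofPred_eq]
  tauto

theorem portion_coprime_left_elements :
    Filter.Tendsto
      (fun g : ℕ =>
        (({S : NumericalSemigroup | S.genus = g ∧
            setGcd (S.leftElements \ {0}) = 1}.ncard : ℝ)) /
          ({S : NumericalSemigroup | S.genus = g}.ncard : ℝ))
      Filter.atTop (nhds 1) := by
  have hlim : Filter.Tendsto (fun g : ℕ => 64 * ((g : ℝ) ^ 2 * (159 / 160) ^ g))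
      Filter.atTop (nhds 0) := by
    simpa using (tendsto_pow_const_mul_const_pow_of_abs_lt_one 2
      (show |(159 / 160 : ℝ)| < 1 by rw [abs_of_pos] <;> norm_num)).const_mul 64
  have hbad := squeeze_zero' (Filter.Eventually.of_forall fun g : ℕ => by positivity)
    ((Filter.eventually_gt_atTop 0).mono fun g hg => ncard_setGcd_ne_one_div_le hg) hlim
  have hgood := hbad.const_sub 1
  rw [sub_zero] at hgood
  refine hgood.congr fun g => ?_
  have hpos : (0 : ℝ) < {S : NumericalSemigroup | S.genus = g}.ncard :=
    mod_cast ncard_genus_eq_pos g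
  have hadd := congrArg (Nat.cast (R := ℝ)) (ncard_setGcd_eq_one_add g)
  rw [Nat.cast_add] at hadd
  rw [eq_div_iff hpos.ne', sub_mul, one_mul, div_mul_cancel₀ _ hpos.ne']
  linarith
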